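/- arXiv:2308.10002 — 2 statements merged into one kernel-verified Lean document; each statement's English description precedes it below -/
import Mathlib

section
/- If α > λ_{k+1}(V), then for every real number β the functional J_{α,β}(u) = (1/2)∫_V (|∇u|² − α u²) dμ − β log ∫_V h e^u dμ satisfies inf_{u ∈ E_k^⊥} J_{α,β}(u) = −∞. -/
open Finset

variable {V : Type*}

/-- Integral of `g` over `V` with respect to the measure `μ`. -/
noncomputable def intV [Fintype V] (μ g : V → ℝ) : ℝ := ∑ x, μ x * g x

/-- Volume of `V` with respect to the measure `μ`. -/
noncomputable def volV [Fintype V] (μ : V → ℝ) : ℝ := ∑ x, μ x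

/-- The space `H` of functions with zero mean. -/
def Hsp [Fintype V] (μ : V → ℝ) : Set (V → ℝ) := {u | intV μ u = 0}

/-- `|∇u|²(x)`, the squared length of the gradient of `u` at `x`. -/
noncomputable def gradSq [Fintype V] (G : SimpleGraph V) [DecidableRel G.Adj]
    (w : V → V → ℝ) (μ : V → ℝ) (u : V → ℝ) (x : V) : ℝ :=
  (1 / (2 * μ x)) * ∑ y, if G.Adj x y then w x y * (u y - u x) ^ 2 else 0

/-- The `μ`-Laplacian `Δu(x)`. -/
noncomputable def lapV [Fintype V] (G : SimpleGraph V) [DecidableRel G.Adj]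
    (w : V → V → ℝ) (μ : V → ℝ) (u : V → ℝ) (x : V) : ℝ :=
  (1 / μ x) * ∑ y, if G.Adj x y then w x y * (u y - u x) else 0

/-- The functional `J_β`. -/
noncomputable def Jb [Fintype V] (G : SimpleGraph V) [DecidableRel G.Adj]
    (w : V → V → ℝ) (μ h : V → ℝ) (β : ℝ) (u : V → ℝ) : ℝ :=
  (1 / 2) * intV μ (gradSq G w μ u)
    - β * Real.log (intV μ (fun x => h x * Real.exp (u x)))

/-- The functional `J_{α,β}`. -/
noncomputable def Jab [Fintype V] (G : SimpleGraph V) [DecidableRel G.Adj]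
    (w : V → V → ℝ) (μ h : V → ℝ) (α β : ℝ) (u : V → ℝ) : ℝ :=
  (1 / 2) * intV μ (fun x => gradSq G w μ u x - α * u x ^ 2)
    - β * Real.log (intV μ (fun x => h x * Real.exp (u x)))

/-- The first non-zero eigenvalue `λ₁(V)` of `-Δ`, defined variationally. -/
noncomputable def lam1V [Fintype V] (G : SimpleGraph V) [DecidableRel G.Adj]
    (w : V → V → ℝ) (μ : V → ℝ) : ℝ :=
  sInf ((fun u => intV μ (gradSq G w μ u)) ''
    {u | u ∈ Hsp μ ∧ intV μ (fun x => u x ^ 2) = 1})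

/-- The eigenspace of `-Δ` with eigenvalue `c` (inside `H`). -/
def eigSp [Fintype V] (G : SimpleGraph V) [DecidableRel G.Adj]
    (w : V → V → ℝ) (μ : V → ℝ) (c : ℝ) : Set (V → ℝ) :=
  {v | intV μ v = 0 ∧ ∀ x, -(lapV G w μ v x) = c * v x}

/-- `E_k^⊥`: functions in `H` orthogonal to the eigenspaces of the first `k`
distinct non-zero eigenvalues (`lam` lists the distinct non-zero eigenvalues,
0-indexed, so `lam ⟨s⟩` is `λ_{s+1}(V)`). -/
def EkPerp [Fintype V] (G : SimpleGraph V) [DecidableRel G.Adj]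
    (w : V → V → ℝ) (μ : V → ℝ) {m : ℕ} (lam : Fin m → ℝ) (k : ℕ) : Set (V → ℝ) :=
  {u | u ∈ Hsp μ ∧ ∀ s : Fin m, (s : ℕ) < k → ∀ v ∈ eigSp G w μ (lam s),
    intV μ (fun x => u x * v x) = 0}

/-- Green's formula for the `μ`-Laplacian. -/
theorem intV_neg_lapV_mul [Fintype V] (G : SimpleGraph V) [DecidableRel G.Adj]
    (w : V → V → ℝ) (hws : ∀ x y, w x y = w y x) (μ : V → ℝ) (hμ : ∀ x, 0 < μ x)
    (u v : V → ℝ) :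
    intV μ (fun x => -(lapV G w μ u x) * v x) =
      (1 / 2) * ∑ x, ∑ y, if G.Adj x y then w x y * ((u y - u x) * (v y - v x)) else 0 := by
  have hlap : intV μ (fun x => -(lapV G w μ u x) * v x) =
      ∑ x, ∑ y, if G.Adj x y then w x y * ((u x - u y) * v x) else 0 := by
    refine Finset.sum_congr rfl fun x _ => ?_
    have hx := (hμ x).ne'
    simp only [lapV]
    calc _ = -(∑ y, if G.Adj x y then w x y * (u y - u x) else 0) * v x := by field_simp
      _ = _ := by
        rw [← Finset.sum_neg_distrib, Finset.sum_mul]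
        refine Finset.sum_congr rfl fun y _ => ?_
        split_ifs <;> ring
  have hswap : (∑ x, ∑ y, if G.Adj x y then w x y * ((u x - u y) * v x) else 0) =
      ∑ x, ∑ y, if G.Adj x y then w x y * ((u y - u x) * v y) else 0 := by
    rw [Finset.sum_comm]
    refine Finset.sum_congr rfl fun x _ => Finset.sum_congr rfl fun y _ => ?_
    simp only [hws y x, G.adj_comm y x]
  have hadd : (∑ x, ∑ y, if G.Adj x y then w x y * ((u y - u x) * (v y - v x)) else 0) =
      (∑ x, ∑ y, if G.Adj x y then w x y * ((u y - u x) * v y) else 0) +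
      ∑ x, ∑ y, if G.Adj x y then w x y * ((u x - u y) * v x) else 0 := by
    simp only [← Finset.sum_add_distrib]
    refine Finset.sum_congr rfl fun x _ => Finset.sum_congr rfl fun y _ => ?_
    split_ifs <;> ring
  rw [hadd, ← hswap, hlap]
  ring

theorem intV_neg_lapV_mul_comm [Fintype V] (G : SimpleGraph V) [DecidableRel G.Adj]
    (w : V → V → ℝ) (hws : ∀ x y, w x y = w y x) (μ : V → ℝ) (hμ : ∀ x, 0 < μ x)
    (u v : V → ℝ) :
    intV μ (fun x => -(lapV G w μ u x) * v x) = intV μ (fun x => -(lapV G w μ v x) * u x) := by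
  simp only [intV_neg_lapV_mul G w hws μ hμ, mul_comm (u _ - u _)]

theorem intV_gradSq [Fintype V] (G : SimpleGraph V) [DecidableRel G.Adj]
    (w : V → V → ℝ) (hws : ∀ x y, w x y = w y x) (μ : V → ℝ) (hμ : ∀ x, 0 < μ x)
    (u : V → ℝ) :
    intV μ (gradSq G w μ u) = intV μ (fun x => -(lapV G w μ u x) * u x) := by
  rw [intV_neg_lapV_mul G w hws μ hμ, intV, Finset.mul_sum]
  refine Finset.sum_congr rfl fun x _ => ?_
  have hx := (hμ x).ne'
  simp only [gradSq, ← sq]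
  field_simp

theorem intV_const_mul [Fintype V] (μ g : V → ℝ) (c : ℝ) :
    intV μ (fun x => c * g x) = c * intV μ g := by
  simp only [intV, Finset.mul_sum]
  exact Finset.sum_congr rfl fun x _ => by ring

theorem intV_sub [Fintype V] (μ f g : V → ℝ) :
    intV μ (fun x => f x - g x) = intV μ f - intV μ g := by
  simp only [intV, mul_sub, Finset.sum_sub_distrib]

theorem intV_mono [Fintype V] {μ f g : V → ℝ} (hμ : ∀ x, 0 < μ x) (hfg : ∀ x, f x ≤ g x) :
    intV μ f ≤ intV μ g :=
  Finset.sum_le_sum fun x _ => mul_le_mul_of_nonneg_left (hfg x) (hμ x).le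

theorem intV_pos [Fintype V] [Nonempty V] {μ f : V → ℝ} (hμ : ∀ x, 0 < μ x)
    (hf : ∀ x, 0 < f x) : 0 < intV μ f :=
  Finset.sum_pos (fun x _ => mul_pos (hμ x) (hf x)) Finset.univ_nonempty

/-- Eigenfunctions for distinct eigenvalues are orthogonal. -/
theorem intV_mul_eq_zero_of_eigen [Fintype V] (G : SimpleGraph V) [DecidableRel G.Adj]
    (w : V → V → ℝ) (hws : ∀ x y, w x y = w y x) (μ : V → ℝ) (hμ : ∀ x, 0 < μ x)
    {u v : V → ℝ} {a b : ℝ} (hab : a ≠ b) (hu : ∀ x, -(lapV G w μ u x) = a * u x)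
    (hv : ∀ x, -(lapV G w μ v x) = b * v x) : intV μ (fun x => u x * v x) = 0 := by
  have key := intV_neg_lapV_mul_comm G w hws μ hμ u v
  simp only [hu, hv, mul_assoc, intV_const_mul, mul_comm (v _) (u _)] at key
  have : (a - b) * intV μ (fun x => u x * v x) = 0 := by linarith
  exact (mul_eq_zero.mp this).resolve_left (sub_ne_zero.mpr hab)

/-- The logarithmic term differs from its value at `u = 0` by at most `sup |u|`. -/
theorem abs_log_intV_exp_sub_le [Fintype V] [Nonempty V] {μ h u : V → ℝ}
    (hμ : ∀ x, 0 < μ x) (hh : ∀ x, 0 < h x) {M : ℝ} (hM : ∀ x, |u x| ≤ M) :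
    |Real.log (intV μ (fun x => h x * Real.exp (u x))) - Real.log (intV μ h)| ≤ M := by
  have hS := intV_pos hμ hh
  have hI : 0 < intV μ (fun x => h x * Real.exp (u x)) :=
    intV_pos hμ fun x => mul_pos (hh x) (Real.exp_pos _)
  have hupper : intV μ (fun x => h x * Real.exp (u x)) ≤ Real.exp M * intV μ h := by
    rw [← intV_const_mul]
    refine intV_mono hμ fun x => ?_
    rw [mul_comm]
    exact mul_le_mul_of_nonneg_right (Real.exp_le_exp.mpr (abs_le.mp (hM x)).2) (hh x).le
  have hlower : Real.exp (-M) * intV μ h ≤ intV μ (fun x => h x * Real.exp (u x)) := by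
    rw [← intV_const_mul]
    refine intV_mono hμ fun x => ?_
    rw [mul_comm (h x)]
    exact mul_le_mul_of_nonneg_right (Real.exp_le_exp.mpr (abs_le.mp (hM x)).1) (hh x).le
  have h1 := Real.log_le_log hI hupper
  have h2 := Real.log_le_log (by positivity) hlower
  rw [Real.log_mul (Real.exp_pos _).ne' hS.ne', Real.log_exp] at h1 h2
  exact abs_le.mpr ⟨by linarith, by linarith⟩

/-- Along the ray through an eigenfunction, `J_{α,β}` is bounded by a quadratic polynomial. -/
theorem Jab_smul_le_of_eigen [Fintype V] [Nonempty V] (G : SimpleGraph V) [DecidableRel G.Adj]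
    (w : V → V → ℝ) (hws : ∀ x y, w x y = w y x) {μ h : V → ℝ} (hμ : ∀ x, 0 < μ x)
    (hh : ∀ x, 0 < h x) (α β : ℝ) {v : V → ℝ} {c : ℝ}
    (hv : ∀ x, -(lapV G w μ v x) = c * v x) {M : ℝ} (hM : ∀ x, |v x| ≤ M)
    {t : ℝ} (ht : 0 ≤ t) :
    Jab G w μ h α β (fun x => t * v x) ≤
      |β| * (t * M + |Real.log (intV μ h)|) -
        (α - c) / 2 * intV μ (fun x => v x ^ 2) * t ^ 2 := by
  have hlap : ∀ x, -(lapV G w μ (fun x => t * v x) x) = c * (t * v x) := by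
    intro x
    have : lapV G w μ (fun x => t * v x) x = t * lapV G w μ v x := by
      simp only [lapV, Finset.mul_sum]
      refine Finset.sum_congr rfl fun y _ => ?_
      split_ifs <;> ring
    rw [this]
    linear_combination t * hv x
  have hquad : intV μ (fun x => gradSq G w μ (fun x => t * v x) x - α * (t * v x) ^ 2) =
      (c - α) * t ^ 2 * intV μ (fun x => v x ^ 2) := by
    rw [intV_sub, intV_gradSq G w hws μ hμ, ← intV_sub, ← intV_const_mul]
    refine Finset.sum_congr rfl fun x _ => ?_
    simp only [hlap]
    ring
  have hlog := abs_log_intV_exp_sub_le (u := fun x => t * v x) hμ hh (M := t * M) fun x => by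
    rw [abs_mul, abs_of_nonneg ht]
    exact mul_le_mul_of_nonneg_left (hM x) ht
  have habs : |Real.log (intV μ (fun x => h x * Real.exp (t * v x)))| ≤
      t * M + |Real.log (intV μ h)| := by
    linarith [abs_sub_abs_le_abs_sub (Real.log (intV μ (fun x => h x * Real.exp (t * v x))))
      (Real.log (intV μ h))]
  have hβ := mul_le_mul_of_nonneg_left habs (abs_nonneg β)
  rw [← abs_mul] at hβ
  have := neg_abs_le (β * Real.log (intV μ (fun x => h x * Real.exp (t * v x))))
  rw [Jab, hquad]
  linarith

theorem stmt6 [Fintype V] (G : SimpleGraph V) [DecidableRel G.Adj]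
    (hG : G.Connected) (w : V → V → ℝ) (hws : ∀ x y, w x y = w y x)
    (hwp : ∀ x y, G.Adj x y → 0 < w x y)
    (μ : V → ℝ) (hμ : ∀ x, 0 < μ x) (h : V → ℝ) (hh : ∀ x, 0 < h x)
    (m : ℕ) (lam : Fin m → ℝ) (hmono : StrictMono lam)
    (hrange : ∀ c : ℝ, c ∈ Set.range lam ↔
      (c ≠ 0 ∧ ∃ v : V → ℝ, v ≠ 0 ∧ ∀ x, -(lapV G w μ v x) = c * v x))
    (k : ℕ) (hk : k < m) (α β : ℝ) (hα : lam ⟨k, hk⟩ < α) :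
    (⨅ u ∈ EkPerp G w μ lam k, (Jab G w μ h α β u : EReal)) = ⊥ := by
  obtain ⟨hc, v, hv0, hv⟩ := (hrange (lam ⟨k, hk⟩)).mp ⟨_, rfl⟩
  have : Nonempty V := hG.nonempty
  have hvmean : intV μ v = 0 := by
    have hone : ∀ x, -(lapV G w μ (fun _ => 1) x) = 0 * (1 : ℝ) := by simp [lapV]
    simpa using intV_mul_eq_zero_of_eigen G w hws μ hμ hc hv hone
  have hmem : ∀ t : ℝ, (fun x => t * v x) ∈ EkPerp G w μ lam k := by
    refine fun t => ⟨?_, fun s hs u hu => ?_⟩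
    · change intV μ (fun x => t * v x) = 0
      rw [intV_const_mul, hvmean, mul_zero]
    · have hne : lam ⟨k, hk⟩ ≠ lam s := (hmono (show s < ⟨k, hk⟩ from hs)).ne'
      simp only [mul_assoc, intV_const_mul,
        intV_mul_eq_zero_of_eigen G w hws μ hμ hne hv hu.2, mul_zero]
  have hN : 0 < intV μ (fun x => v x ^ 2) := by
    obtain ⟨x, hx⟩ := Function.ne_iff.mp hv0
    refine Finset.sum_pos' (fun y _ => mul_nonneg (hμ y).le (sq_nonneg _)) ⟨x, Finset.mem_univ x, ?_⟩
    exact mul_pos (hμ x) (sq_pos_of_ne_zero hx)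
  obtain ⟨M, hM⟩ : ∃ M, ∀ x, |v x| ≤ M :=
    ⟨∑ y, |v y|, fun x => Finset.single_le_sum (f := fun y => |v y|)
      (fun y _ => abs_nonneg _) (Finset.mem_univ x)⟩
  set a := (α - lam ⟨k, hk⟩) / 2 * intV μ (fun x => v x ^ 2)
  have ha : 0 < a := mul_pos (by linarith) hN
  set L := |Real.log (intV μ h)|
  have hlim : Filter.Tendsto (fun t : ℝ => t * (a * t - |β| * M) - |β| * L)
      Filter.atTop Filter.atTop :=
    Filter.tendsto_atTop_add_const_right _ _ (Filter.tendsto_id.atTop_mul_atTop₀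
      (Filter.tendsto_atTop_add_const_right _ _ (Filter.tendsto_id.const_mul_atTop ha)))
  refine (EReal.eq_bot_iff_forall_lt _).mpr fun y => ?_
  obtain ⟨t, hty, ht0⟩ :=
    ((hlim.eventually_gt_atTop (-y)).and (Filter.eventually_ge_atTop 0)).exists
  refine (iInf₂_le _ (hmem t)).trans_lt (EReal.coe_lt_coe_iff.mpr ?_)
  refine (Jab_smul_le_of_eigen G w hws hμ hh α β hv hM ht0).trans_lt ?_
  change |β| * (t * M + L) - a * t ^ 2 < y
  linarith
end

section
/- For every β < 0, the functional J_{λ_{k+1}(V),β}(u) = (1/2)∫_V (|∇u|² − λ_{k+1}(V) u²) dμ − β log ∫_V h e^u dμ attains its infimum over E_{k+1}^⊥ at some u ∈ E_{k+1}^⊥, and this minimizer u satisfies the equation Δu + λ_{k+1}(V)u = −β h e^u / (∫_V h e^u dμ) + β / Vol(V) + Σ_{s=1}^{k+1} Σ_{i=1}^{n_s} (β ∫_V h u_{si} e^u dμ / ∫_V h e^u dμ) · u_{si} on V. -/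
open Finset

variable {V : Type*}

/-- The Dirichlet form `∫_V ∇f · ∇g dμ`. -/
noncomputable def dirichlet [Fintype V] (G : SimpleGraph V) [DecidableRel G.Adj]
    (w : V → V → ℝ) (f g : V → ℝ) : ℝ :=
  ∑ x, ∑ y, if G.Adj x y then w x y * ((f y - f x) * (g y - g x)) / 2 else 0

/-- The `L²(μ)` inner product. -/
noncomputable def innerV [Fintype V] (μ f g : V → ℝ) : ℝ := intV μ (fun x => f x * g x)

section InnerV

variable [Fintype V] {μ : V → ℝ}

lemma innerV_comm (f g : V → ℝ) : innerV μ f g = innerV μ g f := by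
  simp only [innerV, mul_comm]

lemma innerV_add_left (f₁ f₂ g : V → ℝ) :
    innerV μ (f₁ + f₂) g = innerV μ f₁ g + innerV μ f₂ g := by
  simp only [innerV, intV, Pi.add_apply, ← Finset.sum_add_distrib]
  exact Finset.sum_congr rfl fun x _ => by ring

lemma innerV_smul_left (c : ℝ) (f g : V → ℝ) : innerV μ (c • f) g = c * innerV μ f g := by
  simp only [innerV, intV, Pi.smul_apply, smul_eq_mul, Finset.mul_sum]
  exact Finset.sum_congr rfl fun x _ => by ring

lemma innerV_sub_left (f₁ f₂ g : V → ℝ) :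
    innerV μ (f₁ - f₂) g = innerV μ f₁ g - innerV μ f₂ g := by
  simp only [innerV, intV, Pi.sub_apply, ← Finset.sum_sub_distrib]
  exact Finset.sum_congr rfl fun x _ => by ring

lemma innerV_sum_left {ι : Type*} (s : Finset ι) (f : ι → V → ℝ) (g : V → ℝ) :
    innerV μ (∑ i ∈ s, f i) g = ∑ i ∈ s, innerV μ (f i) g := by
  simp only [innerV, intV, Finset.sum_apply, Finset.sum_mul, Finset.mul_sum]
  exact Finset.sum_comm

lemma innerV_add_right (f g₁ g₂ : V → ℝ) :
    innerV μ f (g₁ + g₂) = innerV μ f g₁ + innerV μ f g₂ := by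
  simp only [innerV_comm f, innerV_add_left]

lemma innerV_smul_right (c : ℝ) (f g : V → ℝ) : innerV μ f (c • g) = c * innerV μ f g := by
  simp only [innerV_comm f, innerV_smul_left]

lemma innerV_zero_left (g : V → ℝ) : innerV μ 0 g = 0 := by simp [innerV, intV]

lemma innerV_zero_right (f : V → ℝ) : innerV μ f 0 = 0 := by simp [innerV, intV]

lemma innerV_one_right (f : V → ℝ) : innerV μ f 1 = intV μ f := by simp [innerV]

lemma innerV_self_nonneg (hμ : ∀ x, 0 < μ x) (f : V → ℝ) : 0 ≤ innerV μ f f :=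
  Finset.sum_nonneg fun x _ => mul_nonneg (hμ x).le (mul_self_nonneg _)

lemma innerV_self_eq_zero (hμ : ∀ x, 0 < μ x) {f : V → ℝ} (hf : innerV μ f f = 0) : f = 0 := by
  funext x
  have := (Finset.sum_eq_zero_iff_of_nonneg
    (fun x _ => mul_nonneg (hμ x).le (mul_self_nonneg (f x)))).1 hf x (Finset.mem_univ x)
  simpa [(hμ x).ne'] using this

lemma continuous_innerV_left (g : V → ℝ) : Continuous fun f : V → ℝ => innerV μ f g := by
  unfold innerV intV
  fun_prop

lemma continuous_innerV_self : Continuous fun f : V → ℝ => innerV μ f f := by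
  unfold innerV intV
  fun_prop

end InnerV

section Dirichlet

variable [Fintype V] (G : SimpleGraph V) [DecidableRel G.Adj] (w : V → V → ℝ)

lemma dirichlet_comm (f g : V → ℝ) : dirichlet G w f g = dirichlet G w g f := by
  simp only [dirichlet, mul_comm]

lemma dirichlet_add_left (f₁ f₂ g : V → ℝ) :
    dirichlet G w (f₁ + f₂) g = dirichlet G w f₁ g + dirichlet G w f₂ g := by
  simp only [dirichlet, Pi.add_apply, ← Finset.sum_add_distrib]
  refine Finset.sum_congr rfl fun x _ => Finset.sum_congr rfl fun y _ => ?_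
  split_ifs <;> ring

lemma dirichlet_smul_left (c : ℝ) (f g : V → ℝ) :
    dirichlet G w (c • f) g = c * dirichlet G w f g := by
  simp only [dirichlet, Pi.smul_apply, smul_eq_mul, Finset.mul_sum]
  refine Finset.sum_congr rfl fun x _ => Finset.sum_congr rfl fun y _ => ?_
  split_ifs <;> ring

lemma dirichlet_add_right (f g₁ g₂ : V → ℝ) :
    dirichlet G w f (g₁ + g₂) = dirichlet G w f g₁ + dirichlet G w f g₂ := by
  simp only [dirichlet_comm G w f, dirichlet_add_left]

lemma dirichlet_smul_right (c : ℝ) (f g : V → ℝ) :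
    dirichlet G w f (c • g) = c * dirichlet G w f g := by
  simp only [dirichlet_comm G w f, dirichlet_smul_left]

lemma dirichlet_one_right (f : V → ℝ) : dirichlet G w f 1 = 0 := by simp [dirichlet]

lemma continuous_dirichlet_self : Continuous fun f : V → ℝ => dirichlet G w f f := by
  unfold dirichlet
  refine continuous_finsetSum _ fun x _ => continuous_finsetSum _ fun y _ => ?_
  split_ifs <;> fun_prop

variable {G w}

lemma eq_of_dirichlet_self_eq_zero (hG : G.Connected) (hwp : ∀ x y, G.Adj x y → 0 < w x y)
    {f : V → ℝ} (hf : dirichlet G w f f = 0) (x y : V) : f x = f y := by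
  have nonneg : ∀ x y, 0 ≤ if G.Adj x y then w x y * ((f y - f x) * (f y - f x)) / 2 else 0 := by
    intro x y
    split_ifs with hxy
    · have := mul_nonneg (hwp x y hxy).le (mul_self_nonneg (f y - f x))
      linarith
    · exact le_rfl
  have adj : ∀ x y, G.Adj x y → f x = f y := by
    intro x y hxy
    have h₁ := (Finset.sum_eq_zero_iff_of_nonneg
      (fun x _ => Finset.sum_nonneg fun y _ => nonneg x y)).1 hf x (Finset.mem_univ x)
    have h₂ := (Finset.sum_eq_zero_iff_of_nonneg
      (fun y _ => nonneg x y)).1 h₁ y (Finset.mem_univ y)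
    simp only [hxy, if_true, div_eq_zero_iff, mul_eq_zero, (hwp x y hxy).ne', false_or,
      or_self, OfNat.ofNat_ne_zero, or_false] at h₂
    linarith
  obtain ⟨p⟩ := hG.preconnected x y
  induction p with
  | nil => rfl
  | cons hxy _ ih => exact (adj _ _ hxy).trans ih

variable {μ : V → ℝ}

lemma intV_gradSq_s8 (hμ : ∀ x, 0 < μ x) (f : V → ℝ) :
    intV μ (gradSq G w μ f) = dirichlet G w f f := by
  simp only [intV, gradSq, dirichlet]
  refine Finset.sum_congr rfl fun x _ => ?_
  have := (hμ x).ne'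
  rw [← mul_assoc, show μ x * (1 / (2 * μ x)) = 1 / 2 by field_simp, Finset.mul_sum]
  refine Finset.sum_congr rfl fun y _ => ?_
  split_ifs <;> ring

/-- Green's formula. -/
lemma innerV_lapV (hws : ∀ x y, w x y = w y x) (hμ : ∀ x, 0 < μ x) (f g : V → ℝ) :
    innerV μ (lapV G w μ f) g = -dirichlet G w f g := by
  have key : innerV μ (lapV G w μ f) g =
      ∑ x, ∑ y, if G.Adj x y then w x y * (f y - f x) * g x else 0 := by
    simp only [innerV, intV, lapV]
    refine Finset.sum_congr rfl fun x _ => ?_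
    have := (hμ x).ne'
    rw [← mul_assoc, ← mul_assoc, show μ x * (1 / μ x) = 1 by field_simp, one_mul,
      Finset.sum_mul]
    exact Finset.sum_congr rfl fun y _ => by rw [ite_mul, zero_mul]
  have swap : innerV μ (lapV G w μ f) g =
      ∑ x, ∑ y, if G.Adj x y then w x y * (f x - f y) * g y else 0 := by
    rw [key, Finset.sum_comm]
    exact Finset.sum_congr rfl fun x _ => Finset.sum_congr rfl fun y _ => by
      simp only [G.adj_comm y x, hws y x]
  have add : innerV μ (lapV G w μ f) g + innerV μ (lapV G w μ f) g = -2 * dirichlet G w f g := by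
    nth_rewrite 1 [key]
    rw [swap, dirichlet, Finset.mul_sum, ← Finset.sum_add_distrib]
    refine Finset.sum_congr rfl fun x _ => ?_
    rw [Finset.mul_sum, ← Finset.sum_add_distrib]
    refine Finset.sum_congr rfl fun y _ => ?_
    split_ifs <;> ring
  linarith

lemma intV_lapV (hws : ∀ x y, w x y = w y x) (hμ : ∀ x, 0 < μ x) (f : V → ℝ) :
    intV μ (lapV G w μ f) = 0 := by
  rw [← innerV_one_right, innerV_lapV hws hμ, dirichlet_one_right, neg_zero]

lemma lapV_eq_of_mem_eigSp {c : ℝ} {v : V → ℝ} (hv : v ∈ eigSp G w μ c) :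
    lapV G w μ v = (-c) • v := by
  funext x
  have := hv.2 x
  simp only [Pi.smul_apply, smul_eq_mul]
  linarith

lemma innerV_lapV_of_mem_eigSp (hws : ∀ x y, w x y = w y x) (hμ : ∀ x, 0 < μ x)
    {c : ℝ} {v : V → ℝ} (hv : v ∈ eigSp G w μ c) (f : V → ℝ) :
    innerV μ (lapV G w μ f) v = -c * innerV μ f v := by
  rw [innerV_lapV hws hμ, dirichlet_comm, ← innerV_lapV hws hμ, lapV_eq_of_mem_eigSp hv,
    innerV_smul_left, innerV_comm]

lemma innerV_eq_zero_of_mem_eigSp (hws : ∀ x y, w x y = w y x) (hμ : ∀ x, 0 < μ x)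
    {c d : ℝ} (hcd : c ≠ d) {u v : V → ℝ} (hu : u ∈ eigSp G w μ c) (hv : v ∈ eigSp G w μ d) :
    innerV μ u v = 0 := by
  have h₁ := innerV_lapV_of_mem_eigSp hws hμ hv u
  rw [lapV_eq_of_mem_eigSp hu, innerV_smul_left] at h₁
  have h₂ : (d - c) * innerV μ u v = 0 := by linarith
  exact (mul_eq_zero.1 h₂).resolve_left (sub_ne_zero.2 hcd.symm)

end Dirichlet

section EkPerp

variable [Fintype V] {G : SimpleGraph V} [DecidableRel G.Adj] {w : V → V → ℝ} {μ : V → ℝ}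
  {m : ℕ} {lam : Fin m → ℝ} {k : ℕ}

lemma mem_EkPerp_iff {u : V → ℝ} : u ∈ EkPerp G w μ lam k ↔
    innerV μ u 1 = 0 ∧ ∀ s : Fin m, (s : ℕ) < k → ∀ v ∈ eigSp G w μ (lam s), innerV μ u v = 0 := by
  rw [innerV_one_right]
  exact Iff.rfl

lemma zero_mem_EkPerp : (0 : V → ℝ) ∈ EkPerp G w μ lam k := by
  simp [mem_EkPerp_iff, innerV_zero_left]

lemma add_mem_EkPerp {u v : V → ℝ} (hu : u ∈ EkPerp G w μ lam k)
    (hv : v ∈ EkPerp G w μ lam k) : u + v ∈ EkPerp G w μ lam k := by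
  rw [mem_EkPerp_iff] at *
  refine ⟨by rw [innerV_add_left, hu.1, hv.1, add_zero], fun s hs f hf => ?_⟩
  rw [innerV_add_left, hu.2 s hs f hf, hv.2 s hs f hf, add_zero]

lemma smul_mem_EkPerp (c : ℝ) {u : V → ℝ} (hu : u ∈ EkPerp G w μ lam k) :
    c • u ∈ EkPerp G w μ lam k := by
  rw [mem_EkPerp_iff] at *
  refine ⟨by rw [innerV_smul_left, hu.1, mul_zero], fun s hs f hf => ?_⟩
  rw [innerV_smul_left, hu.2 s hs f hf, mul_zero]

lemma lapV_mem_EkPerp (hws : ∀ x y, w x y = w y x) (hμ : ∀ x, 0 < μ x) {u : V → ℝ}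
    (hu : u ∈ EkPerp G w μ lam k) : lapV G w μ u ∈ EkPerp G w μ lam k := by
  rw [mem_EkPerp_iff] at *
  refine ⟨by rw [innerV_one_right, intV_lapV hws hμ], fun s hs f hf => ?_⟩
  rw [innerV_lapV_of_mem_eigSp hws hμ hf, hu.2 s hs f hf, mul_zero]

lemma isClosed_EkPerp : IsClosed (EkPerp G w μ lam k) := by
  have closed (v : V → ℝ) : IsClosed {u : V → ℝ | innerV μ u v = 0} :=
    isClosed_eq (continuous_innerV_left v) continuous_const
  have : EkPerp G w μ lam k = {u | innerV μ u 1 = 0} ∩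
      ⋂ (s : Fin m) (_ : (s : ℕ) < k) (v ∈ eigSp G w μ (lam s)), {u | innerV μ u v = 0} := by
    ext u
    simp [mem_EkPerp_iff]
  rw [this]
  exact (closed 1).inter (isClosed_iInter fun s => isClosed_iInter fun _ =>
    isClosed_iInter fun v => isClosed_iInter fun _ => closed v)

end EkPerp

section Rayleigh

variable [Fintype V] {G : SimpleGraph V} [DecidableRel G.Adj] {w : V → V → ℝ} {μ : V → ℝ}

lemma isCompact_unit_sphere_inter (hμ : ∀ x, 0 < μ x) {S : Set (V → ℝ)} (hS : IsClosed S) :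
    IsCompact {u | u ∈ S ∧ innerV μ u u = 1} := by
  refine IsCompact.of_isClosed_subset
    (isCompact_Icc (a := fun x => -(1 + 1 / μ x)) (b := fun x => 1 + 1 / μ x)) ?_ ?_
  · exact hS.inter (isClosed_eq continuous_innerV_self continuous_const)
  · rintro u ⟨-, hu⟩
    have bound (x : V) : |u x| ≤ 1 + 1 / μ x := by
      have h₁ : μ x * (u x * u x) ≤ 1 := hu ▸ Finset.single_le_sum
        (f := fun x => μ x * (u x * u x))
        (fun x _ => mul_nonneg (hμ x).le (mul_self_nonneg _)) (Finset.mem_univ x)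
      have h₂ : u x * u x ≤ 1 / μ x := by rwa [le_div_iff₀' (hμ x)]
      have h₃ := abs_mul_abs_self (u x)
      nlinarith [sq_nonneg (|u x| - 1), abs_nonneg (u x)]
    exact ⟨fun x => (abs_le.1 (bound x)).1, fun x => (abs_le.1 (bound x)).2⟩

lemma eq_zero_of_forall_quadratic_nonneg {b c : ℝ} (h : ∀ t : ℝ, 0 ≤ t * b + t ^ 2 * c) :
    b = 0 := by
  have hd := discrim_le_zero (a := c) (b := b) (c := 0) fun t => by linarith [h t]
  simp only [discrim, mul_zero, sub_zero] at hd
  exact pow_eq_zero_iff two_ne_zero |>.1 (le_antisymm hd (sq_nonneg b))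

/-- On a nontrivial closed invariant subspace the Laplacian has an eigenvector realizing the minimum
of the Rayleigh quotient. -/
lemma exists_rayleigh_minimizer (hws : ∀ x y, w x y = w y x) (hμ : ∀ x, 0 < μ x)
    {S : Set (V → ℝ)} (hS : IsClosed S) (hadd : ∀ u ∈ S, ∀ v ∈ S, u + v ∈ S)
    (hsmul : ∀ (c : ℝ), ∀ u ∈ S, c • u ∈ S) (hlap : ∀ u ∈ S, lapV G w μ u ∈ S)
    {v : V → ℝ} (hv : v ∈ S) (hv0 : v ≠ 0) :
    ∃ c : ℝ, ∃ u ∈ S, u ≠ 0 ∧ lapV G w μ u = (-c) • u ∧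
      ∀ f ∈ S, c * innerV μ f f ≤ dirichlet G w f f := by
  have normalize : ∀ f ∈ S, f ≠ 0 → ∃ a : ℝ, 0 < innerV μ f f ∧ a ^ 2 * innerV μ f f = 1 ∧
      a • f ∈ {u | u ∈ S ∧ innerV μ u u = 1} := by
    intro f hf hf0
    have hpos : 0 < innerV μ f f := lt_of_le_of_ne (innerV_self_nonneg hμ f)
      fun h => hf0 (innerV_self_eq_zero hμ h.symm)
    have ha : (1 / √(innerV μ f f)) ^ 2 * innerV μ f f = 1 := by
      rw [div_pow, Real.sq_sqrt hpos.le]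
      field_simp
    refine ⟨1 / √(innerV μ f f), hpos, ha, hsmul _ _ hf, ?_⟩
    rw [innerV_smul_left, innerV_smul_right, ← mul_assoc, ← sq, ha]
  obtain ⟨a, -, -, hmem⟩ := normalize v hv hv0
  obtain ⟨u, ⟨huS, hu1⟩, hmin⟩ := (isCompact_unit_sphere_inter hμ hS).exists_isMinOn ⟨_, hmem⟩
    (continuous_dirichlet_self G w).continuousOn
  have hle : ∀ f ∈ S, dirichlet G w u u * innerV μ f f ≤ dirichlet G w f f := by
    intro f hf
    by_cases hf0 : f = 0
    · subst hf0
      have : dirichlet G w (0 : V → ℝ) 0 = 0 := by simp [dirichlet]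
      rw [this, innerV_zero_left, mul_zero]
    obtain ⟨a, hpos, ha, hmem⟩ := normalize f hf hf0
    have h₁ : dirichlet G w u u ≤ dirichlet G w (a • f) (a • f) := hmin hmem
    rw [dirichlet_smul_left, dirichlet_smul_right] at h₁
    calc dirichlet G w u u * innerV μ f f
        ≤ a * (a * dirichlet G w f f) * innerV μ f f := by gcongr
      _ = (a ^ 2 * innerV μ f f) * dirichlet G w f f := by ring
      _ = dirichlet G w f f := by rw [ha, one_mul]
  refine ⟨dirichlet G w u u, u, huS, ?_, ?_, hle⟩
  · rintro rfl
    rw [innerV_zero_left] at hu1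
    exact zero_ne_one hu1
  · set c := dirichlet G w u u with hc
    set g := lapV G w μ u + c • u with hg
    have hgS : g ∈ S := hadd _ (hlap u huS) _ (hsmul c u huS)
    have hgg : innerV μ g g = -dirichlet G w u g + c * innerV μ u g := by
      conv_lhs => arg 2; rw [hg]
      rw [innerV_add_left, innerV_lapV hws hμ, innerV_smul_left]
    have h0 := eq_zero_of_forall_quadratic_nonneg (b := -2 * innerV μ g g)
      (c := dirichlet G w g g - c * innerV μ g g) fun t => by
        have := hle _ (hadd u huS _ (hsmul t g hgS))
        simp only [innerV_add_left, innerV_add_right, innerV_smul_left, innerV_smul_right,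
          dirichlet_add_left, dirichlet_add_right, dirichlet_smul_left, dirichlet_smul_right,
          innerV_comm g u, dirichlet_comm G w g u, hu1, ← hc] at this
        rw [hgg] at this ⊢
        linarith
    have hg0 : g = 0 := innerV_self_eq_zero hμ (by linarith)
    rw [neg_smul]
    exact eq_neg_of_add_eq_zero_left hg0

end Rayleigh

section Functional

variable [Fintype V] {G : SimpleGraph V} [DecidableRel G.Adj] {w : V → V → ℝ} {μ h : V → ℝ}

lemma Jab_eq (hμ : ∀ x, 0 < μ x) (α β : ℝ) (u : V → ℝ) :
    Jab G w μ h α β u = (1 / 2) * (dirichlet G w u u - α * innerV μ u u)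
      - β * Real.log (intV μ fun x => h x * Real.exp (u x)) := by
  rw [Jab, ← intV_gradSq_s8 hμ]
  congr 2
  simp only [innerV, intV, Finset.mul_sum, ← Finset.sum_sub_distrib]
  exact Finset.sum_congr rfl fun x _ => by ring

lemma intV_mul_exp_pos [Nonempty V] (hμ : ∀ x, 0 < μ x) (hh : ∀ x, 0 < h x) (u : V → ℝ) :
    0 < intV μ fun x => h x * Real.exp (u x) :=
  Finset.sum_pos (fun x _ => mul_pos (hμ x) (mul_pos (hh x) (Real.exp_pos _)))
    Finset.univ_nonempty

lemma continuous_Jab [Nonempty V] (hμ : ∀ x, 0 < μ x) (hh : ∀ x, 0 < h x) (α β : ℝ) :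
    Continuous (Jab G w μ h α β) := by
  rw [funext (Jab_eq (G := G) (w := w) (h := h) hμ α β)]
  have hexp : Continuous fun u : V → ℝ => intV μ fun x => h x * Real.exp (u x) := by
    unfold intV
    fun_prop
  exact (continuous_const.mul ((continuous_dirichlet_self G w).sub
    (continuous_const.mul continuous_innerV_self))).sub
    (continuous_const.mul (hexp.log fun u => (intV_mul_exp_pos hμ hh u).ne'))

/-- A closed set of mean-zero functions on which the quadratic part is nonnegative contains a
minimizer of `J_{α,β}` when `β < 0`. -/
lemma exists_Jab_minimizer [Nonempty V] (hμ : ∀ x, 0 < μ x) (hh : ∀ x, 0 < h x) {α β : ℝ}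
    (hβ : β < 0) {S : Set (V → ℝ)} (hS : IsClosed S) (hne : S.Nonempty)
    (hmean : ∀ u ∈ S, intV μ u = 0)
    (hquad : ∀ u ∈ S, α * innerV μ u u ≤ dirichlet G w u u) :
    ∃ u ∈ S, ∀ v ∈ S, Jab G w μ h α β u ≤ Jab G w μ h α β v := by
  obtain ⟨v₀, hv₀⟩ := hne
  set K := Jab G w μ h α β v₀
  obtain ⟨M, hM⟩ := Finite.exists_le fun x => K / -β - Real.log (μ x * h x)
  have hcompact : IsCompact {u | u ∈ S ∧ Jab G w μ h α β u ≤ K} := by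
    refine IsCompact.of_isClosed_subset
      (isCompact_Icc (a := fun x => M - M * volV μ / μ x) (b := fun _ => M))
      (hS.inter (isClosed_le (continuous_Jab hμ hh α β) continuous_const)) ?_
    rintro u ⟨huS, huK⟩
    have hlog : Real.log (intV μ fun x => h x * Real.exp (u x)) ≤ K / -β := by
      rw [Jab_eq hμ] at huK
      rw [le_div_iff₀ (by linarith)]
      linarith [hquad u huS]
    have upper (x : V) : u x ≤ M := by
      have h₁ : μ x * h x * Real.exp (u x) ≤ intV μ fun x => h x * Real.exp (u x) := by
        rw [mul_assoc]
        exact Finset.single_le_sum (f := fun x => μ x * (h x * Real.exp (u x)))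
          (fun x _ => (mul_pos (hμ x) (mul_pos (hh x) (Real.exp_pos _))).le) (Finset.mem_univ x)
      have hpos := mul_pos (hμ x) (hh x)
      have h₂ := Real.log_le_log (mul_pos hpos (Real.exp_pos _)) h₁
      rw [Real.log_mul hpos.ne' (Real.exp_pos _).ne', Real.log_exp] at h₂
      linarith [hM x]
    refine ⟨fun x => ?_, upper⟩
    have h₁ : μ x * (M - u x) ≤ ∑ y, μ y * (M - u y) :=
      Finset.single_le_sum (f := fun y => μ y * (M - u y))
        (fun y _ => mul_nonneg (hμ y).le (sub_nonneg.2 (upper y))) (Finset.mem_univ x)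
    have h₂ : ∑ y, μ y * (M - u y) = M * volV μ := by
      have := hmean u huS
      simp only [intV] at this
      simp only [mul_sub, Finset.sum_sub_distrib, this, sub_zero, volV, ← Finset.sum_mul]
      ring
    have h₃ : M - u x ≤ M * volV μ / μ x := by
      rw [le_div_iff₀' (hμ x)]
      linarith
    show M - M * volV μ / μ x ≤ u x
    linarith
  obtain ⟨u, ⟨huS, huK⟩, hmin⟩ := hcompact.exists_isMinOn ⟨v₀, hv₀, le_rfl⟩
    (continuous_Jab (G := G) (w := w) hμ hh α β).continuousOn
  refine ⟨u, huS, fun v hv => ?_⟩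
  rcases le_total (Jab G w μ h α β v) K with hvK | hvK
  · exact hmin ⟨hv, hvK⟩
  · exact huK.trans hvK

lemma hasDerivAt_Jab [Nonempty V] (hμ : ∀ x, 0 < μ x) (hh : ∀ x, 0 < h x) (α β : ℝ)
    (u g : V → ℝ) :
    HasDerivAt (fun t : ℝ => Jab G w μ h α β (u + t • g))
      (dirichlet G w u g - α * innerV μ u g
        - β * (intV μ (fun x => h x * g x * Real.exp (u x))
          / intV μ fun x => h x * Real.exp (u x))) 0 := by
  have hquad : HasDerivAt (fun t : ℝ => (1 / 2) * (dirichlet G w (u + t • g) (u + t • g)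
      - α * innerV μ (u + t • g) (u + t • g))) (dirichlet G w u g - α * innerV μ u g) 0 := by
    have hpoly : HasDerivAt (fun t : ℝ => (1 / 2) * (dirichlet G w u u - α * innerV μ u u)
        + t * (dirichlet G w u g - α * innerV μ u g)
        + t ^ 2 * ((1 / 2) * (dirichlet G w g g - α * innerV μ g g)))
        (dirichlet G w u g - α * innerV μ u g) 0 := by
      have := (((hasDerivAt_id (0 : ℝ)).mul_const (dirichlet G w u g - α * innerV μ u g)).const_add
        ((1 / 2) * (dirichlet G w u u - α * innerV μ u u))).add
        (((hasDerivAt_id (0 : ℝ)).pow 2).mul_const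
          ((1 / 2) * (dirichlet G w g g - α * innerV μ g g)))
      exact this.congr_deriv (by simp)
    refine hpoly.congr_of_eventuallyEq (Filter.Eventually.of_forall fun t => ?_)
    simp only [innerV_add_left, innerV_add_right, innerV_smul_left, innerV_smul_right,
      dirichlet_add_left, dirichlet_add_right, dirichlet_smul_left, dirichlet_smul_right,
      innerV_comm g u, dirichlet_comm G w g u]
    ring
  have hexp : HasDerivAt (fun t : ℝ => intV μ fun x => h x * Real.exp ((u + t • g) x))
      (intV μ fun x => h x * g x * Real.exp (u x)) 0 := by
    unfold intV
    refine HasDerivAt.fun_sum fun x _ => ?_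
    have h₁ : HasDerivAt (fun t : ℝ => u x + t * g x) (g x) 0 := by
      simpa using ((hasDerivAt_id (0 : ℝ)).mul_const (g x)).const_add (u x)
    refine ((h₁.exp.const_mul (h x)).const_mul (μ x)).congr_deriv ?_
    simp only [zero_mul, add_zero]
    ring
  have hlog := hexp.log (intV_mul_exp_pos hμ hh _).ne'
  rw [zero_smul, add_zero] at hlog
  rw [funext fun t : ℝ => Jab_eq (G := G) (w := w) (h := h) hμ α β (u + t • g)]
  exact hquad.sub (hlog.const_mul β)

end Functional

theorem stmt8 [Fintype V] (G : SimpleGraph V) [DecidableRel G.Adj]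
    (hG : G.Connected) (w : V → V → ℝ) (hws : ∀ x y, w x y = w y x)
    (hwp : ∀ x y, G.Adj x y → 0 < w x y)
    (μ : V → ℝ) (hμ : ∀ x, 0 < μ x) (h : V → ℝ) (hh : ∀ x, 0 < h x)
    (m : ℕ) (lam : Fin m → ℝ) (hmono : StrictMono lam)
    (hrange : ∀ c : ℝ, c ∈ Set.range lam ↔
      (c ≠ 0 ∧ ∃ v : V → ℝ, v ≠ 0 ∧ ∀ x, -(lapV G w μ v x) = c * v x))
    (n : Fin m → ℕ) (U : (s : Fin m) → Fin (n s) → V → ℝ)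
    (hUeig : ∀ s i, U s i ∈ eigSp G w μ (lam s))
    (hUon : ∀ s i j, intV μ (fun x => U s i x * U s j x) = if i = j then 1 else 0)
    (hUspan : ∀ s, ∀ v ∈ eigSp G w μ (lam s), v ∈ Submodule.span ℝ (Set.range (U s)))
    (k : ℕ) (hk : k < m) (β : ℝ) (hβ : β < 0) :
    ∃ u ∈ EkPerp G w μ lam (k + 1),
      (∀ v ∈ EkPerp G w μ lam (k + 1),
        Jab G w μ h (lam ⟨k, hk⟩) β u ≤ Jab G w μ h (lam ⟨k, hk⟩) β v) ∧
      ∀ x, lapV G w μ u x + lam ⟨k, hk⟩ * u x =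
        -(β * h x * Real.exp (u x)) / intV μ (fun y => h y * Real.exp (u y))
          + β / volV μ
          + ∑ s : Fin m, ∑ i : Fin (n s),
              if (s : ℕ) < k + 1 then
                (β * intV μ (fun y => h y * U s i y * Real.exp (u y))
                  / intV μ (fun y => h y * Real.exp (u y))) * U s i x
              else 0 := by
  have : Nonempty V := hG.nonempty
  set S := EkPerp G w μ lam (k + 1)
  set α := lam ⟨k, hk⟩
  have hquad : ∀ v ∈ S, α * innerV μ v v ≤ dirichlet G w v v := by
    intro v hv
    by_cases hv0 : v = 0
    · subst hv0
      simp [innerV_zero_left, dirichlet]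
    obtain ⟨c, f, hfS, hf0, hlap, hle⟩ := exists_rayleigh_minimizer hws hμ
      (isClosed_EkPerp (G := G) (w := w) (μ := μ) (lam := lam) (k := k + 1))
      (fun _ hu _ hv => add_mem_EkPerp hu hv) (fun c _ hu => smul_mem_EkPerp c hu)
      (fun _ hu => lapV_mem_EkPerp hws hμ hu) hv hv0
    have heig : ∀ x, -(lapV G w μ f x) = c * f x := fun x => by simp [hlap]
    have hff : innerV μ f f ≠ 0 := fun h => hf0 (innerV_self_eq_zero hμ h)
    have hc0 : c ≠ 0 := by
      rintro rfl
      have hd : dirichlet G w f f = 0 := by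
        have := innerV_lapV (G := G) hws hμ f f
        rw [hlap, neg_zero, zero_smul, innerV_zero_left] at this
        linarith
      obtain ⟨x₀⟩ := this
      have hconst : f = f x₀ • (1 : V → ℝ) := by
        funext x
        simpa using eq_of_dirichlet_self_eq_zero hG hwp hd x x₀
      apply hff
      nth_rewrite 2 [hconst]
      rw [innerV_smul_right, (mem_EkPerp_iff.1 hfS).1, mul_zero]
    obtain ⟨s, rfl⟩ := (hrange c).2 ⟨hc0, f, hf0, heig⟩
    have hs : k < s := by
      by_contra hs
      exact hff ((mem_EkPerp_iff.1 hfS).2 s (by omega) f ⟨hfS.1, heig⟩)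
    have hlt : α < lam s := hmono (Fin.mk_lt_of_lt_val hs)
    calc α * innerV μ v v ≤ lam s * innerV μ v v :=
          mul_le_mul_of_nonneg_right hlt.le (innerV_self_nonneg hμ v)
      _ ≤ _ := hle v hv
  obtain ⟨u, huS, hmin⟩ := exists_Jab_minimizer hμ hh hβ isClosed_EkPerp ⟨0, zero_mem_EkPerp⟩
    (fun u hu => hu.1) hquad
  refine ⟨u, huS, hmin, ?_⟩
  set I := intV μ fun y => h y * Real.exp (u y) with hI
  have hIpos : 0 < I := intV_mul_exp_pos hμ hh u
  set e : V → ℝ := fun x => h x * Real.exp (u x) with he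
  set a : (s : Fin m) → Fin (n s) → ℝ := fun s i =>
    if (s : ℕ) < k + 1 then β * innerV μ e (U s i) / I else 0 with ha
  set p : V → ℝ := ∑ s, ∑ i, a s i • U s i with hp
  set g : V → ℝ := lapV G w μ u + α • u + (β / I) • e - (β / volV μ) • 1 - p with hg
  have huS' := mem_EkPerp_iff.1 huS
  have hU1 (s i) : innerV μ (U s i) 1 = 0 := by rw [innerV_one_right]; exact (hUeig s i).1
  have inner_p (f : V → ℝ) : innerV μ p f = ∑ s, ∑ i, a s i * innerV μ (U s i) f := by
    simp only [hp, innerV_sum_left, innerV_smul_left]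
  have inner_g (f : V → ℝ) : innerV μ g f = innerV μ (lapV G w μ u) f + α * innerV μ u f
      + β / I * innerV μ e f - β / volV μ * innerV μ 1 f - innerV μ p f := by
    simp only [hg, innerV_sub_left, innerV_add_left, innerV_smul_left]
  have hgS : g ∈ S := by
    refine mem_EkPerp_iff.2 ⟨?_, fun s hs v hv => ?_⟩
    · have hvol : 0 < volV μ := Finset.sum_pos (fun x _ => hμ x) Finset.univ_nonempty
      have h₁ : innerV μ 1 1 = volV μ := by simp [innerV, intV, volV]
      have h₂ : innerV μ e 1 = I := innerV_one_right e
      rw [inner_g, h₁, h₂, huS'.1, innerV_one_right, intV_lapV hws hμ, inner_p]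
      simp only [hU1, mul_zero, Finset.sum_const_zero]
      field_simp
      ring
    · refine Submodule.span_induction (p := fun v _ => innerV μ g v = 0) ?_
        (innerV_zero_right g) (fun x y _ _ hx hy => by rw [innerV_add_right, hx, hy, add_zero])
        (fun c x _ hx => by rw [innerV_smul_right, hx, mul_zero]) (hUspan s v hv)
      rintro _ ⟨j, rfl⟩
      have h₁ : innerV μ p (U s j) = β * innerV μ e (U s j) / I := by
        rw [inner_p, Finset.sum_eq_single s, Finset.sum_eq_single j]
        · have : innerV μ (U s j) (U s j) = 1 := (hUon s j j).trans (if_pos rfl)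
          rw [this, mul_one]
          simp only [ha, hs, if_true]
        · intro i _ hij
          have : innerV μ (U s i) (U s j) = 0 := (hUon s i j).trans (if_neg hij)
          rw [this, mul_zero]
        · simp
        · intro t _ hts
          refine Finset.sum_eq_zero fun i _ => ?_
          rw [innerV_eq_zero_of_mem_eigSp hws hμ (hmono.injective.ne hts) (hUeig t i) (hUeig s j),
            mul_zero]
        · simp
      rw [inner_g, h₁, innerV_lapV_of_mem_eigSp hws hμ (hUeig s j),
        huS'.2 s hs _ (hUeig s j), innerV_comm 1, hU1]
      ring
  have hderiv := hasDerivAt_Jab (G := G) (w := w) hμ hh α β u g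
  have hcrit : dirichlet G w u g - α * innerV μ u g - β * (innerV μ e g / I) = 0 := by
    have hloc : IsLocalMin (fun t : ℝ => Jab G w μ h α β (u + t • g)) 0 :=
      Filter.Eventually.of_forall fun t => by
        simpa using hmin _ (add_mem_EkPerp huS (smul_mem_EkPerp t hgS))
    have hint : innerV μ e g = intV μ fun x => h x * g x * Real.exp (u x) := by
      simp only [innerV, he, mul_right_comm]
    rw [hint]
    exact hloc.hasDerivAt_eq_zero hderiv
  have hgS' := mem_EkPerp_iff.1 hgS
  have hgg : innerV μ g g = 0 := by
    have h₁ : innerV μ p g = 0 := by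
      rw [inner_p]
      refine Finset.sum_eq_zero fun s _ => Finset.sum_eq_zero fun i _ => ?_
      by_cases hs : (s : ℕ) < k + 1
      · rw [innerV_comm, hgS'.2 s hs _ (hUeig s i), mul_zero]
      · simp only [ha, if_neg hs, zero_mul]
    rw [inner_g, h₁, innerV_comm 1, hgS'.1, innerV_lapV hws hμ]
    linear_combination -hcrit
  intro x
  have hgx : g x = 0 := congrFun (innerV_self_eq_zero hμ hgg) x
  have hpx : p x = ∑ s : Fin m, ∑ i : Fin (n s), if (s : ℕ) < k + 1 then
      (β * intV μ (fun y => h y * U s i y * Real.exp (u y)) / I) * U s i x else 0 := by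
    simp only [hp, Finset.sum_apply, Pi.smul_apply, smul_eq_mul, ha, ite_mul, zero_mul]
    refine Finset.sum_congr rfl fun s _ => Finset.sum_congr rfl fun i _ => ?_
    simp only [innerV, he, mul_right_comm]
  rw [← hpx]
  simp only [hg, Pi.sub_apply, Pi.add_apply, Pi.smul_apply, smul_eq_mul, Pi.one_apply, he] at hgx
  linear_combination hgx
end
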